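/- arXiv:1806.01771 — 10 statements merged into one kernel-verified Lean document; each statement's English description precedes it below -/
import Mathlib

section
/- Let (Ω, μ) be a measure space and let p, q : Ω → ℝ be measurable functions with p ≥ 0, q ≥ 0, ∫ p dμ = 1, ∫ q dμ = 1, and p > 0 μ-almost everywhere. Let f : ℝ → ℝ and f⋆ : ℝ → ℝ satisfy the Fenchel–Young inequality t·u − f⋆(t) ≤ f(u) for all u ≥ 0 and all t ∈ ℝ. Let T : Ω → ℝ be measurable and suppose the functions ω ↦ q(ω)·T(ω), ω ↦ p(ω)·f⋆(T(ω)), and ω ↦ p(ω)·f(q(ω)/p(ω)) are μ-integrable. Then ∫ q(ω)·T(ω) dμ(ω) − ∫ p(ω)·f⋆(T(ω)) dμ(ω) ≤ ∫ p(ω)·f(q(ω)/p(ω)) dμ(ω). -/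
open MeasureTheory

/-- Nguyen–Wainwright–Jordan variational lower bound on the f-divergence
`D_f(p‖q) = ∫ p · f(q/p) dμ`. -/
theorem nwj_variational_lower_bound
    {Ω : Type*} [MeasurableSpace Ω] (μ : Measure Ω)
    (p q : Ω → ℝ) (hp : Measurable p) (hq : Measurable q)
    (hp0 : ∀ ω, 0 ≤ p ω) (hq0 : ∀ ω, 0 ≤ q ω)
    (hpInt : ∫ ω, p ω ∂μ = 1) (hqInt : ∫ ω, q ω ∂μ = 1)
    (hppos : ∀ᵐ ω ∂μ, 0 < p ω)
    (f fstar : ℝ → ℝ)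
    (hFY : ∀ u : ℝ, 0 ≤ u → ∀ t : ℝ, t * u - fstar t ≤ f u)
    (T : Ω → ℝ) (hT : Measurable T)
    (h1 : Integrable (fun ω => q ω * T ω) μ)
    (h2 : Integrable (fun ω => p ω * fstar (T ω)) μ)
    (h3 : Integrable (fun ω => p ω * f (q ω / p ω)) μ) :
    ∫ ω, q ω * T ω ∂μ - ∫ ω, p ω * fstar (T ω) ∂μ
      ≤ ∫ ω, p ω * f (q ω / p ω) ∂μ := by
  rw [← integral_sub h1 h2]
  refine integral_mono_ae (h1.sub h2) h3 ?_
  filter_upwards [hppos] with ω hω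
  calc q ω * T ω - p ω * fstar (T ω)
      = p ω * (T ω * (q ω / p ω) - fstar (T ω)) := by field_simp
    _ ≤ p ω * f (q ω / p ω) :=
        mul_le_mul_of_nonneg_left (hFY _ (div_nonneg (hq0 ω) hω.le) _) hω.le
end

section
/- Let (X, μ_X) and (Z, μ_Z) be σ-finite measure spaces. Let q* : X → ℝ be a probability density with respect to μ_X, let p* : Z → ℝ be a probability density with respect to μ_Z with p* > 0 μ_Z-almost everywhere, and let q : Z × X → ℝ be measurable and nonnegative with ∫_Z q(z, x) dμ_Z(z) = 1 for μ_X-almost every x (an amortized conditional density q(z|x)). Let f, f⋆ : ℝ → ℝ satisfy the Fenchel–Young inequality t·u − f⋆(t) ≤ f(u) for all u ≥ 0 and all t ∈ ℝ, and let g : ℝ → ℝ. Then: (i) for every measurable T : Z × X → ℝ for which all integrands below are integrable, ∬ q*(x)·q(z,x)·T(z,x) dμ_Z dμ_X − ∬ q*(x)·p*(z)·f⋆(T(z,x)) dμ_Z dμ_X ≤ ∬ q*(x)·p*(z)·f(q(z,x)/p*(z)) dμ_Z dμ_X; and (ii) if moreover u·g(u) − f⋆(g(u)) = f(u) for all u ≥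 0, then equality holds for T(z,x) = g(q(z,x)/p*(z)). -/
open MeasureTheory

/-- If the second weight `p` is positive almost everywhere, almost every point of the product
space has a second coordinate where `p` is positive. -/
theorem ae_prod_snd_pos {X Z : Type*} [MeasurableSpace X] [MeasurableSpace Z]
    (μX : Measure X) (μZ : Measure Z) [SFinite μZ] {p : Z → ℝ} (hp : ∀ᵐ z ∂μZ, 0 < p z) :
    ∀ᵐ w ∂(μX.prod μZ), 0 < p w.2 :=
  Measure.quasiMeasurePreserving_snd.ae hp

/-- Rewriting of the variational integrand as a weighted Fenchel–Young expression at `b / p`. -/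
theorem mul_sub_mul_eq_weighted_div {a b p t s : ℝ} (hp : 0 < p) :
    a * b * t - a * p * s = a * p * (t * (b / p) - s) := by
  field_simp

/-- Amortized variational lower bound `L_f^latent` on the expected latent-space
f-divergence `E_{q*(x)}[D_f(p*‖q(·|x))]`, together with its equality case at the
true density ratio. -/
theorem amortized_f_divergence_bound_latent
    {X Z : Type*} [MeasurableSpace X] [MeasurableSpace Z]
    (μX : Measure X) (μZ : Measure Z) [SigmaFinite μX] [SigmaFinite μZ]
    (qs : X → ℝ) (hqs : Measurable qs) (hqs0 : ∀ x, 0 ≤ qs x)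
    (hqs1 : ∫ x, qs x ∂μX = 1)
    (ps : Z → ℝ) (hps : Measurable ps) (hps0 : ∀ z, 0 ≤ ps z)
    (hps1 : ∫ z, ps z ∂μZ = 1) (hpspos : ∀ᵐ z ∂μZ, 0 < ps z)
    (q : Z × X → ℝ) (hq : Measurable q) (hq0 : ∀ zx, 0 ≤ q zx)
    (hq1 : ∀ᵐ x ∂μX, ∫ z, q (z, x) ∂μZ = 1)
    (f fstar g : ℝ → ℝ)
    (hFY : ∀ u : ℝ, 0 ≤ u → ∀ t : ℝ, t * u - fstar t ≤ f u) :
    -- (i) the amortized variational lower bound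
    (∀ T : Z × X → ℝ, Measurable T →
      Integrable (fun p : X × Z => qs p.1 * q (p.2, p.1) * T (p.2, p.1)) (μX.prod μZ) →
      Integrable (fun p : X × Z => qs p.1 * ps p.2 * fstar (T (p.2, p.1))) (μX.prod μZ) →
      Integrable (fun p : X × Z => qs p.1 * ps p.2 * f (q (p.2, p.1) / ps p.2)) (μX.prod μZ) →
      ∫ x, ∫ z, qs x * q (z, x) * T (z, x) ∂μZ ∂μX
        - ∫ x, ∫ z, qs x * ps z * fstar (T (z, x)) ∂μZ ∂μX
        ≤ ∫ x, ∫ z, qs x * ps z * f (q (z, x) / ps z) ∂μZ ∂μX)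
    ∧
    -- (ii) equality at the true density ratio, when `g` attains Fenchel–Young with equality
    ((∀ u : ℝ, 0 ≤ u → u * g u - fstar (g u) = f u) →
      Integrable (fun p : X × Z => qs p.1 * q (p.2, p.1) * g (q (p.2, p.1) / ps p.2)) (μX.prod μZ) →
      Integrable (fun p : X × Z => qs p.1 * ps p.2 * fstar (g (q (p.2, p.1) / ps p.2))) (μX.prod μZ) →
      Integrable (fun p : X × Z => qs p.1 * ps p.2 * f (q (p.2, p.1) / ps p.2)) (μX.prod μZ) →
      ∫ x, ∫ z, qs x * q (z, x) * g (q (z, x) / ps z) ∂μZ ∂μX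
        - ∫ x, ∫ z, qs x * ps z * fstar (g (q (z, x) / ps z)) ∂μZ ∂μX
        = ∫ x, ∫ z, qs x * ps z * f (q (z, x) / ps z) ∂μZ ∂μX) := by
  have hpos := ae_prod_snd_pos μX μZ hpspos
  refine ⟨fun T _ h₁ h₂ h₃ ↦ ?_, fun hg h₁ h₂ h₃ ↦ ?_⟩
  · rw [← integral_prod _ h₁, ← integral_prod _ h₂, ← integral_prod _ h₃, ← integral_sub h₁ h₂]
    refine integral_mono_ae (h₁.sub h₂) h₃ ?_
    filter_upwards [hpos] with w hw
    rw [mul_sub_mul_eq_weighted_div hw]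
    exact mul_le_mul_of_nonneg_left (hFY _ (div_nonneg (hq0 _) hw.le) _)
      (mul_nonneg (hqs0 _) hw.le)
  · rw [← integral_prod _ h₁, ← integral_prod _ h₂, ← integral_prod _ h₃, ← integral_sub h₁ h₂]
    refine integral_congr_ae ?_
    filter_upwards [hpos] with w hw
    rw [mul_sub_mul_eq_weighted_div hw, mul_comm (g _), hg _ (div_nonneg (hq0 _) hw.le)]
end

section
/- Let (X, μ_X) and (Z, μ_Z) be σ-finite measure spaces. Let q* : X → ℝ be a probability density with respect to μ_X with q* > 0 μ_X-almost everywhere, let p* : Z → ℝ be a probability density with respect to μ_Z, and let p : X × Z → ℝ be measurable and nonnegative with ∫_X p(x, z) dμ_X(x) = 1 for μ_Z-almost every z (an amortized conditional density p(x|z)). Let f, f⋆ : ℝ → ℝ satisfy the Fenchel–Young inequality t·u − f⋆(t) ≤ f(u) for all u ≥ 0 and all t ∈ ℝ, and let g : ℝ → ℝ. Then: (i) for every measurable T : X × Z → ℝ for which all integrands below are integrable, ∬ p*(z)·p(x,z)·T(x,z) dμ_X dμ_Z − ∬ p*(z)·q*(x)·f⋆(T(x,z)) dμ_X dμ_Z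 ≤ ∬ p*(z)·q*(x)·f(p(x,z)/q*(x)) dμ_X dμ_Z; and (ii) if moreover u·g(u) − f⋆(g(u)) = f(u) for all u ≥ 0, then equality holds for T(x,z) = g(p(x,z)/q*(x)). -/
open MeasureTheory

/-- Amortized variational lower bound `L_f^observed` on the expected observed-space
f-divergence `E_{p*(z)}[D_f(q*‖p(·|z))]`, together with its equality case at the
true density ratio. -/
theorem amortized_f_divergence_bound_observed
    {X Z : Type*} [MeasurableSpace X] [MeasurableSpace Z]
    (μX : Measure X) (μZ : Measure Z) [SigmaFinite μX] [SigmaFinite μZ]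
    (qs : X → ℝ) (hqs : Measurable qs) (hqs0 : ∀ x, 0 ≤ qs x)
    (hqs1 : ∫ x, qs x ∂μX = 1) (hqspos : ∀ᵐ x ∂μX, 0 < qs x)
    (ps : Z → ℝ) (hps : Measurable ps) (hps0 : ∀ z, 0 ≤ ps z)
    (hps1 : ∫ z, ps z ∂μZ = 1)
    (p : X × Z → ℝ) (hp : Measurable p) (hp0 : ∀ xz, 0 ≤ p xz)
    (hp1 : ∀ᵐ z ∂μZ, ∫ x, p (x, z) ∂μX = 1)
    (f fstar g : ℝ → ℝ)
    (hFY : ∀ u : ℝ, 0 ≤ u → ∀ t : ℝ, t * u - fstar t ≤ f u) :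
    -- (i) the amortized variational lower bound
    (∀ T : X × Z → ℝ, Measurable T →
      Integrable (fun pr : Z × X => ps pr.1 * p (pr.2, pr.1) * T (pr.2, pr.1)) (μZ.prod μX) →
      Integrable (fun pr : Z × X => ps pr.1 * qs pr.2 * fstar (T (pr.2, pr.1))) (μZ.prod μX) →
      Integrable (fun pr : Z × X => ps pr.1 * qs pr.2 * f (p (pr.2, pr.1) / qs pr.2)) (μZ.prod μX) →
      ∫ z, ∫ x, ps z * p (x, z) * T (x, z) ∂μX ∂μZ
        - ∫ z, ∫ x, ps z * qs x * fstar (T (x, z)) ∂μX ∂μZ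
        ≤ ∫ z, ∫ x, ps z * qs x * f (p (x, z) / qs x) ∂μX ∂μZ)
    ∧
    -- (ii) equality at the true density ratio, when `g` attains Fenchel–Young with equality
    ((∀ u : ℝ, 0 ≤ u → u * g u - fstar (g u) = f u) →
      Integrable (fun pr : Z × X => ps pr.1 * p (pr.2, pr.1) * g (p (pr.2, pr.1) / qs pr.2)) (μZ.prod μX) →
      Integrable (fun pr : Z × X => ps pr.1 * qs pr.2 * fstar (g (p (pr.2, pr.1) / qs pr.2))) (μZ.prod μX) →
      Integrable (fun pr : Z × X => ps pr.1 * qs pr.2 * f (p (pr.2, pr.1) / qs pr.2)) (μZ.prod μX) →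
      ∫ z, ∫ x, ps z * p (x, z) * g (p (x, z) / qs x) ∂μX ∂μZ
        - ∫ z, ∫ x, ps z * qs x * fstar (g (p (x, z) / qs x)) ∂μX ∂μZ
        = ∫ z, ∫ x, ps z * qs x * f (p (x, z) / qs x) ∂μX ∂μZ) := by
  have hpos : ∀ᵐ pr : Z × X ∂(μZ.prod μX), 0 < qs pr.2 :=
    Measure.quasiMeasurePreserving_snd.ae hqspos
  have hscale : ∀ {q : ℝ}, 0 < q → ∀ s r t : ℝ,
      s * r * t - s * q * fstar t = s * q * (t * (r / q) - fstar t) := by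
    intro q hq s r t
    field_simp
  refine ⟨fun T _ h1 h2 h3 => ?_, fun hg h1 h2 h3 => ?_⟩
  · have e1 := integral_prod _ h1
    have e2 := integral_prod _ h2
    have e3 := integral_prod _ h3
    dsimp only at e1 e2 e3
    rw [← e1, ← e2, ← e3, ← integral_sub h1 h2]
    refine integral_mono_ae (h1.sub h2) h3 ?_
    filter_upwards [hpos] with pr hq
    rw [hscale hq]
    exact mul_le_mul_of_nonneg_left (hFY _ (div_nonneg (hp0 _) hq.le) _)
      (mul_nonneg (hps0 _) hq.le)
  · have e1 := integral_prod _ h1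
    have e2 := integral_prod _ h2
    have e3 := integral_prod _ h3
    dsimp only at e1 e2 e3
    rw [← e1, ← e2, ← e3, ← integral_sub h1 h2]
    refine integral_congr_ae ?_
    filter_upwards [hpos] with pr hq
    rw [hscale hq, mul_comm (g _), hg _ (div_nonneg (hp0 _) hq.le)]
end

section
/- Let (Ω, μ) be a measure space and let p, q : Ω → ℝ be measurable with p ≥ 0, q ≥ 0, ∫ p dμ = 1, ∫ q dμ = 1, and p > 0 μ-almost everywhere. Let r : Ω → ℝ be measurable with r > 0, and suppose the functions q·log r, p·(r − 1), and q·log(q/p) are μ-integrable. Then ∫ q(ω)·log r(ω) dμ(ω) − ∫ p(ω)·(r(ω) − 1) dμ(ω) ≤ ∫ q(ω)·log(q(ω)/p(ω)) dμ(ω), with equality when r = q/p μ-almost everywhere. -/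
open MeasureTheory

theorem Real.mul_log_sub_mul_le {p q r : ℝ} (hp : 0 < p) (hq : 0 ≤ q) (hr : 0 < r) :
    q * Real.log r - p * (r - 1) ≤ q * Real.log (q / p) + (p - q) := by
  rcases hq.eq_or_lt with rfl | hq
  · have := mul_pos hp hr
    simp only [zero_mul]
    linarith
  · have hlog := Real.log_le_sub_one_of_pos (show 0 < r / (q / p) by positivity)
    rw [Real.log_div hr.ne' (by positivity)] at hlog
    have hmul := mul_le_mul_of_nonneg_left hlog hq.le
    have hcancel : q * (r / (q / p) - 1) = p * r - q := by field_simp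
    linarith

/-- The KLIEP-style variational lower bound `L_KL` on the Kullback–Leibler divergence
`KL(q‖p) = ∫ q · log(q/p) dμ`, with equality when `r = q/p` μ-a.e. -/
theorem kl_variational_lower_bound
    {Ω : Type*} [MeasurableSpace Ω] (μ : Measure Ω)
    (p q : Ω → ℝ) (hp : Measurable p) (hq : Measurable q)
    (hp0 : ∀ ω, 0 ≤ p ω) (hq0 : ∀ ω, 0 ≤ q ω)
    (hpInt : ∫ ω, p ω ∂μ = 1) (hqInt : ∫ ω, q ω ∂μ = 1)
    (hppos : ∀ᵐ ω ∂μ, 0 < p ω)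
    (r : Ω → ℝ) (hr : Measurable r) (hrpos : ∀ ω, 0 < r ω)
    (h1 : Integrable (fun ω => q ω * Real.log (r ω)) μ)
    (h2 : Integrable (fun ω => p ω * (r ω - 1)) μ)
    (h3 : Integrable (fun ω => q ω * Real.log (q ω / p ω)) μ) :
    (∫ ω, q ω * Real.log (r ω) ∂μ - ∫ ω, p ω * (r ω - 1) ∂μ
      ≤ ∫ ω, q ω * Real.log (q ω / p ω) ∂μ)
    ∧ ((∀ᵐ ω ∂μ, r ω = q ω / p ω) →
      ∫ ω, q ω * Real.log (r ω) ∂μ - ∫ ω, p ω * (r ω - 1) ∂μ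
        = ∫ ω, q ω * Real.log (q ω / p ω) ∂μ) := by
  have hpI : Integrable p μ := .of_integral_ne_zero (by simp [hpInt])
  have hqI : Integrable q μ := .of_integral_ne_zero (by simp [hqInt])
  have hpqI : Integrable (fun ω => p ω - q ω) μ := hpI.sub hqI
  constructor
  · calc
      _ = ∫ ω, (q ω * Real.log (r ω) - p ω * (r ω - 1)) ∂μ := (integral_sub h1 h2).symm
      _ ≤ ∫ ω, (q ω * Real.log (q ω / p ω) + (p ω - q ω)) ∂μ := by
        refine integral_mono_ae (h1.sub h2) (h3.add hpqI) ?_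
        filter_upwards [hppos] with ω hω
        exact Real.mul_log_sub_mul_le hω (hq0 ω) (hrpos ω)
      _ = _ := by
        rw [integral_add h3 hpqI, integral_sub hpI hqI, hpInt, hqInt, sub_self, add_zero]
  · intro h
    have hlog : ∫ ω, q ω * Real.log (r ω) ∂μ = ∫ ω, q ω * Real.log (q ω / p ω) ∂μ := by
      refine integral_congr_ae ?_
      filter_upwards [h] with ω hω
      rw [hω]
    have hzero : ∫ ω, p ω * (r ω - 1) ∂μ = 0 := by
      calc
        _ = ∫ ω, (q ω - p ω) ∂μ := by
          refine integral_congr_ae ?_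
          filter_upwards [h, hppos] with ω hω hpω
          rw [hω, mul_sub, mul_div_cancel₀ _ hpω.ne', mul_one]
        _ = 0 := by rw [integral_sub hqI hpI, hpInt, hqInt, sub_self]
    rw [hlog, hzero, sub_zero]
end

section
/- Let (X, μ_X) and (Z, μ_Z) be σ-finite measure spaces. Let q* : X → ℝ be a probability density with respect to μ_X, let p* : Z → ℝ be a probability density with respect to μ_Z, let qφ : Z × X → ℝ be a measurable nonnegative function with ∫_Z qφ(z,x) dμ_Z(z) = 1 for μ_X-almost every x, and let pθ : X × Z → ℝ be a measurable nonnegative function with ∫_X pθ(x,z) dμ_X(x) = 1 for μ_Z-almost every z. Assume q*, qφ, p*, pθ are strictly positive almost everywhere where needed and that each of the functions (x,z) ↦ p*(z)·pθ(x,z)·log p*(z), p*(z)·pθ(x,z)·log pθ(x,z), p*(z)·pθ(x,z)·log q*(x), and p*(z)·pθ(x,z)·log qφ(z,x) is integrable with respect to μ_X ⊗ μ_Z. Then ∬ p*(z)·pθ(x,z)·log( (p*(z)·pθ(x,z)) / (q*(x)·qφ(z,x)) ) d(μ_X ⊗ μ_Z) = ∬ p*(z)·pθ(x,z)·(−log qφ(z,x))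 d(μ_X ⊗ μ_Z) + ∬ p*(z)·pθ(x,z)·log(pθ(x,z)/q*(x)) d(μ_X ⊗ μ_Z) − ∫ p*(z)·(−log p*(z)) dμ_Z. -/
open MeasureTheory

/-- The forward KL divergence between the exact joint `p*(z)·pθ(x|z)` and the
variational joint `q*(x)·qφ(z|x)` equals the negative APLBO minus the entropy of
the prior `p*`. -/
theorem forward_joint_kl_eq_naplbo_sub_entropy
    {X Z : Type*} [MeasurableSpace X] [MeasurableSpace Z]
    (μX : Measure X) (μZ : Measure Z) [SigmaFinite μX] [SigmaFinite μZ]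
    (qs : X → ℝ) (hqs : Measurable qs) (hqs0 : ∀ x, 0 ≤ qs x)
    (hqs1 : ∫ x, qs x ∂μX = 1)
    (ps : Z → ℝ) (hps : Measurable ps) (hps0 : ∀ z, 0 ≤ ps z)
    (hps1 : ∫ z, ps z ∂μZ = 1)
    (qφ : Z × X → ℝ) (hqφ : Measurable qφ) (hqφ0 : ∀ zx, 0 ≤ qφ zx)
    (hqφ1 : ∀ᵐ x ∂μX, ∫ z, qφ (z, x) ∂μZ = 1)
    (pθ : X × Z → ℝ) (hpθ : Measurable pθ) (hpθ0 : ∀ xz, 0 ≤ pθ xz)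
    (hpθ1 : ∀ᵐ z ∂μZ, ∫ x, pθ (x, z) ∂μX = 1)
    (hqspos : ∀ᵐ x ∂μX, 0 < qs x)
    (hpspos : ∀ᵐ z ∂μZ, 0 < ps z)
    (hqφpos : ∀ᵐ pr ∂(μX.prod μZ), 0 < qφ (pr.2, pr.1))
    (hpθpos : ∀ᵐ pr ∂(μX.prod μZ), 0 < pθ pr)
    (hI1 : Integrable (fun pr : X × Z =>
      ps pr.2 * pθ pr * Real.log (ps pr.2)) (μX.prod μZ))
    (hI2 : Integrable (fun pr : X × Z =>
      ps pr.2 * pθ pr * Real.log (pθ pr)) (μX.prod μZ))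
    (hI3 : Integrable (fun pr : X × Z =>
      ps pr.2 * pθ pr * Real.log (qs pr.1)) (μX.prod μZ))
    (hI4 : Integrable (fun pr : X × Z =>
      ps pr.2 * pθ pr * Real.log (qφ (pr.2, pr.1))) (μX.prod μZ)) :
    ∫ pr : X × Z, ps pr.2 * pθ pr *
        Real.log ((ps pr.2 * pθ pr) / (qs pr.1 * qφ (pr.2, pr.1))) ∂(μX.prod μZ)
      = ∫ pr : X × Z, ps pr.2 * pθ pr * (-Real.log (qφ (pr.2, pr.1))) ∂(μX.prod μZ)
        + ∫ pr : X × Z, ps pr.2 * pθ pr *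
            Real.log (pθ pr / qs pr.1) ∂(μX.prod μZ)
        - ∫ z, ps z * (-Real.log (ps z)) ∂μZ := by
  have hprior : ∫ pr : X × Z, ps pr.2 * pθ pr * Real.log (ps pr.2) ∂(μX.prod μZ)
      = ∫ z, ps z * Real.log (ps z) ∂μZ := by
    rw [integral_prod_symm _ hI1]
    refine integral_congr_ae ?_
    filter_upwards [hpθ1] with z hz
    calc ∫ x, ps z * pθ (x, z) * Real.log (ps z) ∂μX
        = ∫ x, ps z * Real.log (ps z) * pθ (x, z) ∂μX := by
          congr 1 with x
          ring
      _ = ps z * Real.log (ps z) := by rw [integral_const_mul, hz, mul_one]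
  have hqspos' : ∀ᵐ pr ∂(μX.prod μZ), 0 < qs pr.1 :=
    Measure.quasiMeasurePreserving_fst.ae hqspos
  have hpspos' : ∀ᵐ pr ∂(μX.prod μZ), 0 < ps pr.2 :=
    Measure.quasiMeasurePreserving_snd.ae hpspos
  have hjoint : ∫ pr : X × Z, ps pr.2 * pθ pr *
        Real.log ((ps pr.2 * pθ pr) / (qs pr.1 * qφ (pr.2, pr.1))) ∂(μX.prod μZ)
      = ∫ pr : X × Z, (ps pr.2 * pθ pr * Real.log (ps pr.2)
          + ps pr.2 * pθ pr * Real.log (pθ pr)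
          - ps pr.2 * pθ pr * Real.log (qs pr.1)
          - ps pr.2 * pθ pr * Real.log (qφ (pr.2, pr.1))) ∂(μX.prod μZ) := by
    refine integral_congr_ae ?_
    filter_upwards [hqspos', hpspos', hqφpos, hpθpos] with pr h1 h2 h3 h4
    rw [Real.log_div (mul_pos h2 h4).ne' (mul_pos h1 h3).ne',
      Real.log_mul h2.ne' h4.ne', Real.log_mul h1.ne' h3.ne']
    ring
  have hlik : ∫ pr : X × Z, ps pr.2 * pθ pr * Real.log (pθ pr / qs pr.1) ∂(μX.prod μZ)
      = ∫ pr : X × Z, (ps pr.2 * pθ pr * Real.log (pθ pr)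
          - ps pr.2 * pθ pr * Real.log (qs pr.1)) ∂(μX.prod μZ) := by
    refine integral_congr_ae ?_
    filter_upwards [hqspos', hpθpos] with pr h1 h4
    rw [Real.log_div h4.ne' h1.ne']
    ring
  rw [hjoint, hlik, integral_sub (by exact (hI1.add hI2).sub hI3) hI4,
    integral_sub (by exact hI1.add hI2) hI3, integral_add hI1 hI2, integral_sub hI2 hI3, hprior]
  simp only [mul_neg, integral_neg]
  ring
end

section
/- Let D, K be positive natural numbers and τ > 0. Let q* be a probability measure on EuclideanSpace ℝ (Fin D), let γ_K be the standard Gaussian probability measure on EuclideanSpace ℝ (Fin K), let m : EuclideanSpace ℝ (Fin D) → EuclideanSpace ℝ (Fin K) be measurable, and let μθ : EuclideanSpace ℝ (Fin K) → EuclideanSpace ℝ (Fin D) be continuous. Suppose there exists a function G : EuclideanSpace ℝ (Fin D) × EuclideanSpace ℝ (Fin K) → ℝ, integrable with respect to q* ⊗ γ_K, such that ‖x − μθ(m(x) + t·ε)‖² ≤ G(x, ε) for all x, ε and all t with |t| ≤ 1. Then, as t → 0, the quantity (1/(2τ²)) · ∫_X ∫_{ℝ^K} ‖x − μθ(m(x)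 + t·ε)‖² dγ_K(ε) dq*(x) + (D/2)·log(2π τ²) tends to γ₁ · ∫_X ‖x − μθ(m(x))‖² dq*(x) + δ₁, where γ₁ = 1/(2τ²) and δ₁ = (D/2)·log(π/γ₁). -/
open MeasureTheory Real Filter

/-- The standard Gaussian probability measure on `ℝ^n` (the `n`-fold product of the
standard normal distribution), realized via its density with respect to Lebesgue
measure on `EuclideanSpace ℝ (Fin n)`. -/
noncomputable def stdGaussian (n : ℕ) : Measure (EuclideanSpace ℝ (Fin n)) :=
  volume.withDensity fun ε =>
    ENNReal.ofReal ((2 * π) ^ (-(n : ℝ) / 2) * Real.exp (-‖ε‖ ^ 2 / 2))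

/-- The Gaussian density integrates to one. -/
instance isProbabilityMeasure_stdGaussian (n : ℕ) : IsProbabilityMeasure (stdGaussian n) := by
  constructor
  have hpos : (0 : ℝ) < 2 * π := by positivity
  have hint : ∫ v : EuclideanSpace ℝ (Fin n), Real.exp (-‖v‖ ^ 2 / 2) =
      (2 * π) ^ ((n : ℝ) / 2) := by
    have h := GaussianFourier.integral_rexp_neg_mul_sq_norm
      (V := EuclideanSpace ℝ (Fin n)) (b := 1 / 2) (by norm_num)
    rw [finrank_euclideanSpace_fin] at h
    convert h using 4 <;> ring
  have hintegrable : Integrable fun v : EuclideanSpace ℝ (Fin n) => Real.exp (-‖v‖ ^ 2 / 2) := by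
    refine Integrable.of_integral_ne_zero ?_
    rw [hint]
    positivity
  rw [stdGaussian, withDensity_apply _ MeasurableSet.univ, Measure.restrict_univ,
    ← ofReal_integral_eq_lintegral_ofReal (hintegrable.const_mul _)
      (ae_of_all _ fun _ => by positivity),
    integral_const_mul, hint, ← Real.rpow_add hpos]
  simp [neg_div]

/-- Dominated convergence for the expected squared reconstruction error as the noise scale
tends to zero. -/
theorem tendsto_integral_sq_norm_sub_add_smul
    {E F : Type*} [NormedAddCommGroup E] [MeasurableSpace E] [BorelSpace E]
    [SecondCountableTopology E]
    [NormedAddCommGroup F] [NormedSpace ℝ F] [MeasurableSpace F] [BorelSpace F]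
    [SecondCountableTopology F]
    (μ : Measure E) [SFinite μ] (ν : Measure F) [IsProbabilityMeasure ν]
    {m : E → F} (hm : Measurable m) {g : F → E} (hg : Continuous g)
    {G : E × F → ℝ} (hG : Integrable G (μ.prod ν))
    (hdom : ∀ (x : E) (ε : F) (t : ℝ), |t| ≤ 1 → ‖x - g (m x + t • ε)‖ ^ 2 ≤ G (x, ε)) :
    Tendsto (fun t : ℝ => ∫ x, ∫ ε, ‖x - g (m x + t • ε)‖ ^ 2 ∂ν ∂μ)
      (nhds 0) (nhds (∫ x, ‖x - g (m x)‖ ^ 2 ∂μ)) := by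
  have hmeas (t : ℝ) : AEStronglyMeasurable
      (fun p : E × F => ‖p.1 - g (m p.1 + t • p.2)‖ ^ 2) (μ.prod ν) := by
    have hgm : Measurable g := hg.measurable
    exact Measurable.aestronglyMeasurable (by fun_prop)
  have hbound (t : ℝ) (ht : |t| ≤ 1) (p : E × F) :
      ‖‖p.1 - g (m p.1 + t • p.2)‖ ^ 2‖ ≤ G p := by
    rw [Real.norm_of_nonneg (by positivity)]
    exact hdom p.1 p.2 t ht
  have hsmall : ∀ᶠ t : ℝ in nhds 0, |t| ≤ 1 := by
    filter_upwards [Metric.closedBall_mem_nhds (0 : ℝ) one_pos] with t ht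
    simpa using ht
  have hiter (t : ℝ) (ht : |t| ≤ 1) :
      ∫ p : E × F, ‖p.1 - g (m p.1 + t • p.2)‖ ^ 2 ∂(μ.prod ν) =
        ∫ x, ∫ ε, ‖x - g (m x + t • ε)‖ ^ 2 ∂ν ∂μ :=
    integral_prod _ (hG.mono' (hmeas t) (ae_of_all _ (hbound t ht)))
  have hlim : Tendsto
      (fun t : ℝ => ∫ p : E × F, ‖p.1 - g (m p.1 + t • p.2)‖ ^ 2 ∂(μ.prod ν)) (nhds 0)
      (nhds (∫ p : E × F, ‖p.1 - g (m p.1 + (0 : ℝ) • p.2)‖ ^ 2 ∂(μ.prod ν))) := by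
    refine tendsto_integral_filter_of_dominated_convergence G (Eventually.of_forall hmeas)
      (hsmall.mono fun t ht => ae_of_all _ (hbound t ht)) hG (ae_of_all _ fun p => ?_)
    exact Continuous.tendsto
      (f := fun t : ℝ => ‖p.1 - g (m p.1 + t • p.2)‖ ^ 2) (by fun_prop) 0
  rw [hiter 0 (by simp)] at hlim
  simp only [zero_smul, add_zero, integral_const, probReal_univ, one_smul] at hlim
  exact hlim.congr' (hsmall.mono hiter)

/-- As the posterior variance `t²` tends to zero, the reparameterized negative
expected log likelihood `L_NELL` tends to `γ₁ · ℓ_const^reverse + δ₁`, where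
`ℓ_const^reverse = E_{q*(x)}[‖x − μθ(m(x))‖²]` is the reverse cycle-consistency
loss, `γ₁ = 1/(2τ²)` and `δ₁ = (D/2)·log(π/γ₁)`. -/
theorem nell_tendsto_reverse_cycle_consistency
    {D K : ℕ} (hD : 0 < D) (hK : 0 < K) (τ : ℝ) (hτ : 0 < τ)
    (qstar : Measure (EuclideanSpace ℝ (Fin D))) [IsProbabilityMeasure qstar]
    (m : EuclideanSpace ℝ (Fin D) → EuclideanSpace ℝ (Fin K)) (hm : Measurable m)
    (μθ : EuclideanSpace ℝ (Fin K) → EuclideanSpace ℝ (Fin D)) (hμθ : Continuous μθ)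
    (G : EuclideanSpace ℝ (Fin D) × EuclideanSpace ℝ (Fin K) → ℝ)
    (hG : Integrable G (qstar.prod (stdGaussian K)))
    (hdom : ∀ (x : EuclideanSpace ℝ (Fin D)) (ε : EuclideanSpace ℝ (Fin K)) (t : ℝ),
      |t| ≤ 1 → ‖x - μθ (m x + t • ε)‖ ^ 2 ≤ G (x, ε)) :
    Tendsto
      (fun t : ℝ =>
        (1 / (2 * τ ^ 2)) *
            ∫ x, ∫ ε, ‖x - μθ (m x + t • ε)‖ ^ 2 ∂(stdGaussian K) ∂qstar
          + ((D : ℝ) / 2) * Real.log (2 * π * τ ^ 2))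
      (nhds 0)
      (nhds ((1 / (2 * τ ^ 2)) * ∫ x, ‖x - μθ (m x)‖ ^ 2 ∂qstar
        + ((D : ℝ) / 2) * Real.log (π / (1 / (2 * τ ^ 2))))) := by
  have hδ : π / (1 / (2 * τ ^ 2)) = 2 * π * τ ^ 2 := by
    rw [div_div_eq_mul_div, div_one]
    ring
  rw [hδ]
  exact ((tendsto_integral_sq_norm_sub_add_smul qstar (stdGaussian K) hm hμθ hG
    hdom).const_mul _).add_const _
end

section
/- Let D, K be positive natural numbers and t > 0. Let p* be a probability measure on EuclideanSpace ℝ (Fin K), let γ_D be the standard Gaussian probability measure on EuclideanSpace ℝ (Fin D), let μθ : EuclideanSpace ℝ (Fin K) → EuclideanSpace ℝ (Fin D) be measurable, and let m : EuclideanSpace ℝ (Fin D) → EuclideanSpace ℝ (Fin K) be continuous. Suppose there exists a function G : EuclideanSpace ℝ (Fin K) × EuclideanSpace ℝ (Fin D) → ℝ, integrable with respect to p* ⊗ γ_D, such that ‖z − m(μθ(z) + τ·ξ)‖² ≤ G(z, ξ) for all z, ξ and all τ with |τ| ≤ 1. Then, as τ → 0, the quantity (1/(2t²)) · ∫_Z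 ∫_{ℝ^D} ‖z − m(μθ(z) + τ·ξ)‖² dγ_D(ξ) dp*(z) + (K/2)·log(2π t²) tends to γ₂ · ∫_Z ‖z − m(μθ(z))‖² dp*(z) + δ₂, where γ₂ = 1/(2t²) and δ₂ = (K/2)·log(π/γ₂). -/
open MeasureTheory Real Filter

theorem isProbabilityMeasure_stdGaussian_s9 (n : ℕ) : IsProbabilityMeasure (stdGaussian n) := by
  have hint : ∫ ε : EuclideanSpace ℝ (Fin n),
      (2 * π) ^ (-(n : ℝ) / 2) * Real.exp (-‖ε‖ ^ 2 / 2) = 1 := by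
    have h := GaussianFourier.integral_rexp_neg_mul_sq_norm
      (V := EuclideanSpace ℝ (Fin n)) (b := 1 / 2) (by norm_num)
    have hexp : ∀ ε : EuclideanSpace ℝ (Fin n), -‖ε‖ ^ 2 / 2 = -(1 / 2) * ‖ε‖ ^ 2 := by
      intro ε; ring
    simp_rw [hexp]
    rw [integral_const_mul, h, finrank_euclideanSpace_fin, show π / (1 / 2) = 2 * π by ring,
      ← Real.rpow_add (by positivity), neg_div, neg_add_cancel, Real.rpow_zero]
  constructor
  rw [stdGaussian, withDensity_apply _ MeasurableSet.univ, Measure.restrict_univ,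
    ← ofReal_integral_eq_lintegral_ofReal _ (ae_of_all _ fun ε => by positivity), hint,
    ENNReal.ofReal_one]
  exact .of_integral_ne_zero (by rw [hint]; exact one_ne_zero)

/-- As the likelihood variance `τ²` tends to zero, the reparameterized negative
expected log posterior `L_NELP` tends to `γ₂ · ℓ_const^forward + δ₂`, where
`ℓ_const^forward = E_{p*(z)}[‖z − m(μθ(z))‖²]` is the forward cycle-consistency
loss, `γ₂ = 1/(2t²)` and `δ₂ = (K/2)·log(π/γ₂)`. -/
theorem nelp_tendsto_forward_cycle_consistency
    {D K : ℕ} (hD : 0 < D) (hK : 0 < K) (t : ℝ) (ht : 0 < t)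
    (pstar : Measure (EuclideanSpace ℝ (Fin K))) [IsProbabilityMeasure pstar]
    (μθ : EuclideanSpace ℝ (Fin K) → EuclideanSpace ℝ (Fin D)) (hμθ : Measurable μθ)
    (m : EuclideanSpace ℝ (Fin D) → EuclideanSpace ℝ (Fin K)) (hm : Continuous m)
    (G : EuclideanSpace ℝ (Fin K) × EuclideanSpace ℝ (Fin D) → ℝ)
    (hG : Integrable G (pstar.prod (stdGaussian D)))
    (hdom : ∀ (z : EuclideanSpace ℝ (Fin K)) (ξ : EuclideanSpace ℝ (Fin D)) (τ : ℝ),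
      |τ| ≤ 1 → ‖z - m (μθ z + τ • ξ)‖ ^ 2 ≤ G (z, ξ)) :
    Tendsto
      (fun τ : ℝ =>
        (1 / (2 * t ^ 2)) *
            ∫ z, ∫ ξ, ‖z - m (μθ z + τ • ξ)‖ ^ 2 ∂(stdGaussian D) ∂pstar
          + ((K : ℝ) / 2) * Real.log (2 * π * t ^ 2))
      (nhds 0)
      (nhds ((1 / (2 * t ^ 2)) * ∫ z, ‖z - m (μθ z)‖ ^ 2 ∂pstar
        + ((K : ℝ) / 2) * Real.log (π / (1 / (2 * t ^ 2))))) := by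
  have := isProbabilityMeasure_stdGaussian_s9 D
  set P := pstar.prod (stdGaussian D)
  have hmeas : ∀ τ : ℝ, AEStronglyMeasurable
      (fun p : EuclideanSpace ℝ (Fin K) × EuclideanSpace ℝ (Fin D) =>
        ‖p.1 - m (μθ p.1 + τ • p.2)‖ ^ 2) P := fun τ => by
    have := hm.measurable
    exact Measurable.aestronglyMeasurable (by fun_prop)
  have hbound : ∀ τ : ℝ, |τ| ≤ 1 → ∀ p : EuclideanSpace ℝ (Fin K) × EuclideanSpace ℝ (Fin D),
      ‖‖p.1 - m (μθ p.1 + τ • p.2)‖ ^ 2‖ ≤ G p := fun τ hτ p => by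
    rw [Real.norm_of_nonneg (by positivity)]
    exact hdom p.1 p.2 τ hτ
  have hsmall : ∀ᶠ τ : ℝ in nhds 0, |τ| ≤ 1 := by
    filter_upwards [Metric.closedBall_mem_nhds (0 : ℝ) one_pos] with τ hτ
    simpa using hτ
  have hprod : ∀ τ : ℝ, |τ| ≤ 1 →
      ∫ p, ‖p.1 - m (μθ p.1 + τ • p.2)‖ ^ 2 ∂P =
        ∫ z, ∫ ξ, ‖z - m (μθ z + τ • ξ)‖ ^ 2 ∂(stdGaussian D) ∂pstar := fun τ hτ =>
    integral_prod _ (hG.mono' (hmeas τ) (ae_of_all _ (hbound τ hτ)))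
  have hlim : Tendsto (fun τ : ℝ => ∫ p, ‖p.1 - m (μθ p.1 + τ • p.2)‖ ^ 2 ∂P) (nhds 0)
      (nhds (∫ p, ‖p.1 - m (μθ p.1 + (0 : ℝ) • p.2)‖ ^ 2 ∂P)) := by
    refine tendsto_integral_filter_of_dominated_convergence G (.of_forall hmeas)
      (hsmall.mono fun τ hτ => ae_of_all _ (hbound τ hτ)) hG (ae_of_all _ fun p => ?_)
    have hcont : Continuous fun τ : ℝ => ‖p.1 - m (μθ p.1 + τ • p.2)‖ ^ 2 := by fun_prop
    exact hcont.tendsto 0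
  rw [hprod 0 (by simp)] at hlim
  simp only [zero_smul, add_zero, integral_const, probReal_univ, one_smul] at hlim
  rw [show π / (1 / (2 * t ^ 2)) = 2 * π * t ^ 2 by field_simp]
  exact ((hlim.congr' (hsmall.mono hprod)).const_mul _).add_const _
end

section
/- Define f_GAN : ℝ → ℝ by f_GAN(u) = u·log u − (u + 1)·log(u + 1). Then for every t < 0, the set { t·u − f_GAN(u) : u ∈ (0, ∞) } has greatest element −log(1 − exp t); that is, t·u − f_GAN(u) ≤ −log(1 − exp t) for all u > 0, with equality at u = exp(t)/(1 − exp(t)). -/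
/-- The GAN convex function `f_GAN(u) = u·log u − (u+1)·log(u+1)`. -/
noncomputable def fGAN (u : ℝ) : ℝ := u * Real.log u - (u + 1) * Real.log (u + 1)

theorem mul_sub_fGAN_le {t u : ℝ} (ht : t < 0) (hu : 0 < u) :
    t * u - fGAN u ≤ -Real.log (1 - Real.exp t) := by
  have hq : 0 < 1 - Real.exp t := sub_pos.2 (Real.exp_lt_one_iff.2 ht)
  have hu1 : 0 < u + 1 := by positivity
  have hp : 0 < Real.exp t := Real.exp_pos t
  have h₁ := Real.log_le_sub_one_of_pos (show 0 < Real.exp t * (u + 1) / u by positivity)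
  have h₂ := Real.log_le_sub_one_of_pos (mul_pos hq hu1)
  rw [Real.log_div (by positivity) hu.ne', Real.log_mul hp.ne' hu1.ne', Real.log_exp] at h₁
  rw [Real.log_mul hq.ne' hu1.ne'] at h₂
  have h₃ := mul_le_mul_of_nonneg_left h₁ hu.le
  have h₄ : u * (Real.exp t * (u + 1) / u - 1) = Real.exp t * (u + 1) - u := by
    field_simp
  unfold fGAN
  linarith

theorem mul_sub_fGAN_exp_div {t : ℝ} (ht : t < 0) :
    t * (Real.exp t / (1 - Real.exp t)) - fGAN (Real.exp t / (1 - Real.exp t))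
      = -Real.log (1 - Real.exp t) := by
  have hq : 1 - Real.exp t ≠ 0 := (sub_pos.2 (Real.exp_lt_one_iff.2 ht)).ne'
  have hu1 : Real.exp t / (1 - Real.exp t) + 1 = (1 - Real.exp t)⁻¹ := by
    field_simp
    ring
  rw [fGAN, hu1, Real.log_div (Real.exp_ne_zero t) hq, Real.log_inv, Real.log_exp, ← hu1]
  ring

/-- The convex (Legendre–Fenchel) conjugate of `f_GAN` on `t < 0`: the set
`{t·u − f_GAN(u) : u > 0}` has greatest element `−log(1 − exp t)`, i.e.
`t·u − f_GAN(u) ≤ −log(1 − exp t)` for all `u > 0`, with equality at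
`u = exp t / (1 − exp t)`. -/
theorem fGAN_conjugate (t : ℝ) (ht : t < 0) :
    IsGreatest {y : ℝ | ∃ u : ℝ, 0 < u ∧ y = t * u - fGAN u}
      (-Real.log (1 - Real.exp t))
    ∧ (∀ u : ℝ, 0 < u → t * u - fGAN u ≤ -Real.log (1 - Real.exp t))
    ∧ t * (Real.exp t / (1 - Real.exp t)) - fGAN (Real.exp t / (1 - Real.exp t))
        = -Real.log (1 - Real.exp t) := by
  refine ⟨⟨⟨Real.exp t / (1 - Real.exp t), ?_, (mul_sub_fGAN_exp_div ht).symm⟩, ?_⟩,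
    fun u hu => mul_sub_fGAN_le ht hu, mul_sub_fGAN_exp_div ht⟩
  · exact div_pos (Real.exp_pos t) (sub_pos.2 (Real.exp_lt_one_iff.2 ht))
  · rintro y ⟨u, hu, rfl⟩
    exact mul_sub_fGAN_le ht hu
end

section
/- Let (X, μ_X) and (Z, μ_Z) be σ-finite measure spaces. Let q* : X → ℝ be a probability density with respect to μ_X, let p* : Z → ℝ be a probability density with respect to μ_Z with p* > 0 μ_Z-almost everywhere, and let qφ : Z × X → ℝ be measurable and nonnegative with ∫_Z qφ(z,x) dμ_Z(z) = 1 for μ_X-almost every x. Define f_GAN(u) = u·log u − (u + 1)·log(u + 1). Then for every measurable D : Z × X → ℝ with 0 < D(z,x) < 1 for all (z,x), assuming all integrands below are integrable, ∬ q*(x)·p*(z)·log D(z,x) d(μ_X ⊗ μ_Z) + ∬ q*(x)·qφ(z,x)·log(1 − D(z,x)) d(μ_X ⊗ μ_Z) ≤ ∬ q*(x)·p*(z)·f_GAN(qφ(z,x)/p*(z)) d(μ_X ⊗ μ_Z), with equality when D(z,x) = p*(z)/(p*(z) + qφ(z,x)) almost everywhere. -/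
open MeasureTheory

/-- For `p > 0`, `p · f_GAN(q/p)` is the value of the binary cross-entropy objective at the
optimal discriminator `p / (p + q)`. -/
lemma mul_fGAN_div {p q : ℝ} (hp : 0 < p) (hq : 0 ≤ q) :
    p * fGAN (q / p) = p * Real.log (p / (p + q)) + q * Real.log (q / (p + q)) := by
  have hpq : 0 < p + q := by linarith
  have h1 : q / p + 1 = (p + q) / p := by field_simp; ring
  unfold fGAN
  rw [h1, Real.log_div hpq.ne' hp.ne', Real.log_div hp.ne' hpq.ne']
  rcases hq.eq_or_lt with rfl | hq
  · simp
  · rw [Real.log_div hq.ne' hp.ne', Real.log_div hq.ne' hpq.ne']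
    field_simp
    ring

lemma mul_log_le_mul_log_div_add {a d s : ℝ} (ha : 0 ≤ a) (hd : 0 < d) (hs : 0 < s) :
    a * Real.log d ≤ a * Real.log (a / s) + (d * s - a) := by
  rcases ha.eq_or_lt with rfl | ha
  · simp only [zero_mul, sub_zero, zero_add]
    positivity
  · have h := mul_le_mul_of_nonneg_left
      (Real.log_le_sub_one_of_pos (show 0 < d * s / a by positivity)) ha.le
    rw [Real.log_div (by positivity) ha.ne', Real.log_mul hd.ne' hs.ne', mul_sub_one,
      mul_div_cancel₀ _ ha.ne'] at h
    rw [Real.log_div ha.ne' hs.ne']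
    linarith

lemma mul_log_add_mul_log_one_sub_le_mul_fGAN {p q d : ℝ} (hp : 0 < p) (hq : 0 ≤ q)
    (hd0 : 0 < d) (hd1 : d < 1) :
    p * Real.log d + q * Real.log (1 - d) ≤ p * fGAN (q / p) := by
  have hpq : 0 < p + q := by linarith
  rw [mul_fGAN_div hp hq]
  linarith [mul_log_le_mul_log_div_add hp.le hd0 hpq,
    mul_log_le_mul_log_div_add hq (sub_pos.2 hd1) hpq]

lemma mul_log_add_mul_log_one_sub_eq_mul_fGAN {p q : ℝ} (hp : 0 < p) (hq : 0 ≤ q) :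
    p * Real.log (p / (p + q)) + q * Real.log (1 - p / (p + q)) = p * fGAN (q / p) := by
  have hpq : p + q ≠ 0 := by linarith
  rw [mul_fGAN_div hp hq, one_sub_div hpq, add_sub_cancel_left]

/-- The reverse adversarial (GAN) objective `L_GAN^reverse` with discriminator `D`
is a lower bound on the expected `f_GAN`-divergence
`E_{q*(x)}[D_{f_GAN}(p*‖qφ(·|x))]`, with equality when
`D(z,x) = p*(z)/(p*(z) + qφ(z,x))` almost everywhere. -/
theorem gan_reverse_lower_bound
    {X Z : Type*} [MeasurableSpace X] [MeasurableSpace Z]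
    (μX : Measure X) (μZ : Measure Z) [SigmaFinite μX] [SigmaFinite μZ]
    (qs : X → ℝ) (hqs : Measurable qs) (hqs0 : ∀ x, 0 ≤ qs x)
    (hqs1 : ∫ x, qs x ∂μX = 1)
    (ps : Z → ℝ) (hps : Measurable ps) (hps0 : ∀ z, 0 ≤ ps z)
    (hps1 : ∫ z, ps z ∂μZ = 1) (hpspos : ∀ᵐ z ∂μZ, 0 < ps z)
    (qφ : Z × X → ℝ) (hqφ : Measurable qφ) (hqφ0 : ∀ zx, 0 ≤ qφ zx)
    (hqφ1 : ∀ᵐ x ∂μX, ∫ z, qφ (z, x) ∂μZ = 1)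
    (Dis : Z × X → ℝ) (hDis : Measurable Dis)
    (hDis01 : ∀ zx, 0 < Dis zx ∧ Dis zx < 1)
    (hI1 : Integrable (fun pr : X × Z =>
      qs pr.1 * ps pr.2 * Real.log (Dis (pr.2, pr.1))) (μX.prod μZ))
    (hI2 : Integrable (fun pr : X × Z =>
      qs pr.1 * qφ (pr.2, pr.1) * Real.log (1 - Dis (pr.2, pr.1))) (μX.prod μZ))
    (hI3 : Integrable (fun pr : X × Z =>
      qs pr.1 * ps pr.2 * fGAN (qφ (pr.2, pr.1) / ps pr.2)) (μX.prod μZ)) :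
    (∫ pr : X × Z, qs pr.1 * ps pr.2 * Real.log (Dis (pr.2, pr.1)) ∂(μX.prod μZ)
        + ∫ pr : X × Z, qs pr.1 * qφ (pr.2, pr.1) *
            Real.log (1 - Dis (pr.2, pr.1)) ∂(μX.prod μZ)
      ≤ ∫ pr : X × Z, qs pr.1 * ps pr.2 * fGAN (qφ (pr.2, pr.1) / ps pr.2) ∂(μX.prod μZ))
    ∧ ((∀ᵐ pr ∂(μX.prod μZ),
          Dis (pr.2, pr.1) = ps pr.2 / (ps pr.2 + qφ (pr.2, pr.1))) →
      ∫ pr : X × Z, qs pr.1 * ps pr.2 * Real.log (Dis (pr.2, pr.1)) ∂(μX.prod μZ)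
        + ∫ pr : X × Z, qs pr.1 * qφ (pr.2, pr.1) *
            Real.log (1 - Dis (pr.2, pr.1)) ∂(μX.prod μZ)
        = ∫ pr : X × Z, qs pr.1 * ps pr.2 * fGAN (qφ (pr.2, pr.1) / ps pr.2) ∂(μX.prod μZ)) := by
  have hpos : ∀ᵐ pr ∂(μX.prod μZ), 0 < ps pr.2 :=
    Measure.quasiMeasurePreserving_snd.ae hpspos
  rw [← integral_add hI1 hI2]
  constructor
  · refine integral_mono_ae (hI1.add hI2) hI3 ?_
    filter_upwards [hpos] with pr hp
    have h := mul_le_mul_of_nonneg_left (mul_log_add_mul_log_one_sub_le_mul_fGAN hp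
      (hqφ0 (pr.2, pr.1)) (hDis01 (pr.2, pr.1)).1 (hDis01 (pr.2, pr.1)).2) (hqs0 pr.1)
    simpa only [mul_add, mul_assoc, Pi.add_apply] using h
  · intro hD
    refine integral_congr_ae ?_
    filter_upwards [hpos, hD] with pr hp hd
    have h := congrArg (qs pr.1 * ·)
      (mul_log_add_mul_log_one_sub_eq_mul_fGAN hp (hqφ0 (pr.2, pr.1)))
    simpa only [hd, mul_add, mul_assoc] using h
end

section
/- Let (Ω, μ) be a measure space and let p, q : Ω → ℝ be measurable with p > 0 and q > 0 μ-almost everywhere, ∫ p dμ = 1 and ∫ q dμ = 1. Define f_GAN(u) = u·log u − (u + 1)·log(u + 1). Assuming the integrands below are integrable, ∫ p(ω)·f_GAN(q(ω)/p(ω)) dμ(ω) = 2·( (1/2)·∫ p(ω)·log( p(ω) / ((p(ω) + q(ω))/2) ) dμ(ω) + (1/2)·∫ q(ω)·log( q(ω) / ((p(ω) + q(ω))/2) ) dμ(ω) ) − log 4. -/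
open MeasureTheory

/-- Pointwise form of the decomposition of the `f_GAN`-divergence into the two relative-entropy
integrands against the midpoint. -/
lemma mul_fGAN_div_s16 {a b : ℝ} (ha : 0 < a) (hb : 0 < b) :
    a * fGAN (b / a) = (a * Real.log (a / ((a + b) / 2)) + b * Real.log (b / ((a + b) / 2)))
      - (a + b) * Real.log 2 := by
  have hab : a + b ≠ 0 := by positivity
  have hdiv : b / a + 1 = (a + b) / a := by
    field_simp
    ring
  rw [fGAN, hdiv, Real.log_div hb.ne' ha.ne', Real.log_div hab ha.ne',
    Real.log_div ha.ne' (by positivity), Real.log_div hb.ne' (by positivity),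
    Real.log_div hab two_ne_zero]
  field_simp
  ring

/-- For probability densities `p` and `q` with respect to `μ`, the `f_GAN`-divergence
`D_{f_GAN}(p‖q) = ∫ p · f_GAN(q/p) dμ` equals `2·JS(p‖q) − log 4`, where
`JS(p‖q) = (1/2)·KL(p‖(p+q)/2) + (1/2)·KL(q‖(p+q)/2)` is the Jensen–Shannon
divergence. -/
theorem fGAN_divergence_eq_two_js_sub_log_four
    {Ω : Type*} [MeasurableSpace Ω] (μ : Measure Ω)
    (p q : Ω → ℝ) (hp : Measurable p) (hq : Measurable q)
    (hppos : ∀ᵐ ω ∂μ, 0 < p ω) (hqpos : ∀ᵐ ω ∂μ, 0 < q ω)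
    (hpInt : ∫ ω, p ω ∂μ = 1) (hqInt : ∫ ω, q ω ∂μ = 1)
    (hI1 : Integrable (fun ω => p ω * fGAN (q ω / p ω)) μ)
    (hI2 : Integrable (fun ω => p ω * Real.log (p ω / ((p ω + q ω) / 2))) μ)
    (hI3 : Integrable (fun ω => q ω * Real.log (q ω / ((p ω + q ω) / 2))) μ) :
    ∫ ω, p ω * fGAN (q ω / p ω) ∂μ
      = 2 * ((1 / 2) * ∫ ω, p ω * Real.log (p ω / ((p ω + q ω) / 2)) ∂μ
            + (1 / 2) * ∫ ω, q ω * Real.log (q ω / ((p ω + q ω) / 2)) ∂μ)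
        - Real.log 4 := by
  have hpI : Integrable p μ := .of_integral_ne_zero (by simp [hpInt])
  have hqI : Integrable q μ := .of_integral_ne_zero (by simp [hqInt])
  have hlog : Real.log 4 = 2 * Real.log 2 := by
    rw [show (4 : ℝ) = 2 ^ 2 by norm_num, Real.log_pow]
    norm_num
  have hcongr : ∫ ω, p ω * fGAN (q ω / p ω) ∂μ
      = ∫ ω, (p ω * Real.log (p ω / ((p ω + q ω) / 2))
          + q ω * Real.log (q ω / ((p ω + q ω) / 2))) - (p ω + q ω) * Real.log 2 ∂μ := by
    refine integral_congr_ae ?_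
    filter_upwards [hppos, hqpos] with ω hpω hqω
    exact mul_fGAN_div_s16 hpω hqω
  have hsum : ∫ ω, (p ω + q ω) * Real.log 2 ∂μ = Real.log 4 := by
    rw [integral_mul_const, integral_add hpI hqI, hpInt, hqInt, hlog]
    norm_num
  rw [hcongr, integral_sub (by exact hI2.add hI3) (by exact (hpI.add hqI).mul_const _),
    integral_add hI2 hI3, hsum]
  ring
end
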